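/- arXiv:1709.08066 — 4 statements merged into one kernel-verified Lean document; each statement's English description precedes it below -/
import Mathlib

section
/- Let k ≥ 2 and 1 ≤ l ≤ k−1. Let U and W be k-dimensional real inner product spaces, A : U → W an invertible linear map, and L ⊆ U an l-dimensional subspace. Assume that ‖A|_L‖ < 𝔪(A|_{L⊥}) and that the subspace A(L⊥) is orthogonal to A(L) in W. Then σ_i(A|_L) = σ_i(A) for 1 ≤ i ≤ l, and σ_{i−l}(A|_{L⊥}) = σ_i(A) for l+1 ≤ i ≤ k. Here A|_L is viewed as a linear map from L onto A(L), and A|_{L⊥} as a linear map from the orthogonal complement L⊥ onto A(L⊥), each subspace carrying the inner product induced from U or W. -/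
open Module
open scoped RealInnerProductSpace

/-- The operator norm `‖T‖ = sup_{‖v‖=1} ‖T v‖` of a linear map between inner product
spaces. -/
noncomputable def opNorm' {U W : Type*} [NormedAddCommGroup U] [InnerProductSpace ℝ U]
    [NormedAddCommGroup W] [InnerProductSpace ℝ W] (T : U →ₗ[ℝ] W) : ℝ :=
  sSup {r : ℝ | ∃ v : U, ‖v‖ = 1 ∧ r = ‖T v‖}

/-- The conorm `𝔪(T) = inf_{‖v‖=1} ‖T v‖` of a linear map between inner product spaces. -/
noncomputable def conorm' {U W : Type*} [NormedAddCommGroup U] [InnerProductSpace ℝ U]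
    [NormedAddCommGroup W] [InnerProductSpace ℝ W] (T : U →ₗ[ℝ] W) : ℝ :=
  sInf {r : ℝ | ∃ v : U, ‖v‖ = 1 ∧ r = ‖T v‖}

/-- The `i`-th singular value (one-based, in increasing order) of a linear map between
real inner product spaces, via the Courant–Fischer min-max characterization:
`σ_i(T) = inf { sup_{v ∈ V, ‖v‖ = 1} ‖T v‖ : V a subspace with dim V = i }`. -/
noncomputable def singularValue {U W : Type*} [NormedAddCommGroup U] [InnerProductSpace ℝ U]
    [NormedAddCommGroup W] [InnerProductSpace ℝ W] (T : U →ₗ[ℝ] W) (i : ℕ) : ℝ :=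
  sInf {c : ℝ | ∃ V : Submodule ℝ U, finrank ℝ V = i ∧
    c = sSup {r : ℝ | ∃ v ∈ V, ‖v‖ = 1 ∧ r = ‖T v‖}}

section SingularValueComparison

variable {U W U' W' : Type*} [NormedAddCommGroup U] [InnerProductSpace ℝ U]
  [NormedAddCommGroup W] [InnerProductSpace ℝ W]
  [NormedAddCommGroup U'] [InnerProductSpace ℝ U']
  [NormedAddCommGroup W'] [InnerProductSpace ℝ W']

theorem norm_map_inv_norm_smul (T : U →ₗ[ℝ] W) (v : U) :
    ‖T (‖v‖⁻¹ • v)‖ = ‖T v‖ / ‖v‖ := by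
  rw [map_smul, norm_smul, norm_inv, norm_norm, div_eq_inv_mul]

theorem norm_map_le_sSup_mul_norm [FiniteDimensional ℝ U] (T : U →ₗ[ℝ] W)
    (V : Submodule ℝ U) {v : U} (hv : v ∈ V) :
    ‖T v‖ ≤ sSup {r : ℝ | ∃ v ∈ V, ‖v‖ = 1 ∧ r = ‖T v‖} * ‖v‖ := by
  rcases eq_or_ne v 0 with rfl | h0
  · simp
  have hpos : 0 < ‖v‖ := norm_pos_iff.mpr h0
  rw [← div_le_iff₀ hpos, ← norm_map_inv_norm_smul]
  refine le_csSup ⟨‖LinearMap.toContinuousLinearMap T‖, ?_⟩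
    ⟨_, V.smul_mem _ hv, norm_smul_inv_norm (𝕜 := ℝ) h0, rfl⟩
  rintro _ ⟨w, -, hw, rfl⟩
  simpa [hw] using (LinearMap.toContinuousLinearMap T).le_opNorm w

theorem norm_map_le_opNorm'_mul_norm [FiniteDimensional ℝ U] (T : U →ₗ[ℝ] W) (v : U) :
    ‖T v‖ ≤ opNorm' T * ‖v‖ := by
  simpa [opNorm'] using norm_map_le_sSup_mul_norm T ⊤ (Submodule.mem_top (x := v))

theorem conorm'_mul_norm_le_norm_map (T : U →ₗ[ℝ] W) (v : U) :
    conorm' T * ‖v‖ ≤ ‖T v‖ := by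
  rcases eq_or_ne v 0 with rfl | h0
  · simp
  have hpos : 0 < ‖v‖ := norm_pos_iff.mpr h0
  rw [← le_div_iff₀ hpos, ← norm_map_inv_norm_smul]
  refine csInf_le ⟨0, ?_⟩ ⟨_, norm_smul_inv_norm (𝕜 := ℝ) h0, rfl⟩
  rintro _ ⟨w, -, rfl⟩
  exact norm_nonneg _

theorem opNorm'_nonneg (T : U →ₗ[ℝ] W) : 0 ≤ opNorm' T := by
  refine Real.sSup_nonneg ?_
  rintro _ ⟨w, -, rfl⟩
  exact norm_nonneg _

theorem exists_submodule_le_finrank_eq [FiniteDimensional ℝ U] (p : Submodule ℝ U) {n : ℕ}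
    (hn : n ≤ finrank ℝ p) : ∃ q ≤ p, finrank ℝ q = n := by
  obtain ⟨f, hf⟩ := exists_linearIndependent_of_le_finrank hn
  refine ⟨(Submodule.span ℝ (Set.range f)).map p.subtype, Submodule.map_subtype_le _ _, ?_⟩
  rw [Submodule.finrank_map_subtype_eq, finrank_span_eq_card hf, Fintype.card_fin]

/-- If every `i`-dimensional subspace on which `T` expands by at most `c` yields an
`i'`-dimensional one on which `T'` expands by at most `c`, then `σ_{i'}(T') ≤ σ_i(T)`. -/
theorem singularValue_le_singularValue [FiniteDimensional ℝ U]
    (T : U →ₗ[ℝ] W) (T' : U' →ₗ[ℝ] W') {i i' : ℕ} (hi : i ≤ finrank ℝ U)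
    (h : ∀ (V : Submodule ℝ U) (c : ℝ), finrank ℝ V = i → 0 ≤ c →
      (∀ v ∈ V, ‖T v‖ ≤ c * ‖v‖) →
      ∃ V' : Submodule ℝ U', finrank ℝ V' = i' ∧ ∀ v ∈ V', ‖T' v‖ ≤ c * ‖v‖) :
    singularValue T' i' ≤ singularValue T i := by
  obtain ⟨V₀, -, hV₀⟩ := exists_submodule_le_finrank_eq (⊤ : Submodule ℝ U) (n := i)
    (by rwa [finrank_top])
  refine le_csInf ⟨_, V₀, hV₀, rfl⟩ ?_
  rintro _ ⟨V, hV, rfl⟩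
  have hc : 0 ≤ sSup {r : ℝ | ∃ v ∈ V, ‖v‖ = 1 ∧ r = ‖T v‖} := by
    refine Real.sSup_nonneg ?_
    rintro _ ⟨w, -, -, rfl⟩
    exact norm_nonneg _
  obtain ⟨V', hV', hbd⟩ := h V _ hV hc fun v hv => norm_map_le_sSup_mul_norm T V hv
  refine le_trans (b := sSup {r : ℝ | ∃ v ∈ V', ‖v‖ = 1 ∧ r = ‖T' v‖})
    (csInf_le ⟨0, ?_⟩ ⟨V', hV', rfl⟩) (Real.sSup_le ?_ hc)
  · rintro _ ⟨V'', -, rfl⟩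
    refine Real.sSup_nonneg ?_
    rintro _ ⟨w, -, -, rfl⟩
    exact norm_nonneg _
  · rintro _ ⟨v, hv, hv1, rfl⟩
    simpa [hv1] using hbd v hv

theorem finrank_le_finrank_comap_subtype_orthogonal [FiniteDimensional ℝ U]
    (L V : Submodule ℝ U) :
    finrank ℝ V - finrank ℝ L ≤ finrank ℝ (V.comap Lᗮ.subtype) := by
  have h1 : finrank ℝ (V.comap Lᗮ.subtype) = finrank ℝ (Lᗮ ⊓ V : Submodule ℝ U) := by
    rw [← Submodule.finrank_map_subtype_eq, Submodule.map_comap_subtype]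
  have h2 := Submodule.finrank_sup_add_finrank_inf_eq Lᗮ V
  have h3 := L.finrank_add_finrank_orthogonal
  have h4 := Submodule.finrank_le (Lᗮ ⊔ V)
  omega

theorem norm_map_add_sq (T : U →ₗ[ℝ] W) {L : Submodule ℝ U}
    (horth : ∀ v ∈ L, ∀ w ∈ Lᗮ, ⟪T v, T w⟫ = (0 : ℝ)) {a b : U} (ha : a ∈ L) (hb : b ∈ Lᗮ) :
    ‖T (a + b)‖ ^ 2 = ‖T a‖ ^ 2 + ‖T b‖ ^ 2 := by
  simpa [sq] using norm_add_sq_eq_norm_sq_add_norm_sq_real (horth a ha b hb)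

theorem norm_add_sq_of_mem_orthogonal {L : Submodule ℝ U} {a b : U}
    (ha : a ∈ L) (hb : b ∈ Lᗮ) : ‖a + b‖ ^ 2 = ‖a‖ ^ 2 + ‖b‖ ^ 2 :=
  norm_map_add_sq LinearMap.id (fun _ hv _ hw => L.inner_right_of_mem_orthogonal hv hw) ha hb

/-- A subspace on which `T` expands by at most `c`, where `c` is less than the expansion of `T` on
all of `Lᗮ`, projects injectively onto a subspace of `L` with the same property. -/
theorem exists_submodule_of_norm_map_le [FiniteDimensional ℝ U] (T : U →ₗ[ℝ] W)
    {L : Submodule ℝ U} (horth : ∀ v ∈ L, ∀ w ∈ Lᗮ, ⟪T v, T w⟫ = (0 : ℝ)) {c m : ℝ}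
    (hc : 0 ≤ c) (hcm : c < m) (hm : ∀ w ∈ Lᗮ, m * ‖w‖ ≤ ‖T w‖) {V : Submodule ℝ U}
    (hV : ∀ v ∈ V, ‖T v‖ ≤ c * ‖v‖) :
    ∃ V' : Submodule ℝ L, finrank ℝ V' = finrank ℝ V ∧
      ∀ v ∈ V', ‖T.comp L.subtype v‖ ≤ c * ‖v‖ := by
  have hc_of_mem : ∀ w ∈ Lᗮ, c * ‖w‖ ≤ ‖T w‖ := fun w hw =>
    (mul_le_mul_of_nonneg_right hcm.le (norm_nonneg w)).trans (hm w hw)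
  let P : U →ₗ[ℝ] L := L.orthogonalProjectionOnto.toLinearMap
  have hQ : ∀ v, v - P v ∈ Lᗮ := fun v => L.sub_starProjection_mem_orthogonal v
  have hinj : Function.Injective (P.domRestrict V) := by
    rw [injective_iff_map_eq_zero]
    rintro ⟨v, hv⟩ h0
    have hPv : P v = 0 := h0
    have h1 := hm v (by simpa [hPv] using hQ v)
    have h2 := hV v hv
    have h3 : ‖v‖ = 0 := by nlinarith [norm_nonneg v]
    simpa using h3
  refine ⟨V.map P, ?_, ?_⟩
  · rw [← LinearMap.range_domRestrict, LinearMap.finrank_range_of_inj hinj]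
  · rintro _ ⟨v, hv, rfl⟩
    have hsum : (P v : U) + (v - P v) = v := by abel
    have h1 := norm_map_add_sq T horth (P v).2 (hQ v)
    have h2 := norm_add_sq_of_mem_orthogonal (P v).2 (hQ v)
    rw [hsum] at h1 h2
    have h3 := pow_le_pow_left₀ (norm_nonneg _) (hV v hv) 2
    have h4 := pow_le_pow_left₀ (by positivity) (hc_of_mem _ (hQ v)) 2
    refine le_of_sq_le_sq ?_ (by positivity)
    change ‖T (P v)‖ ^ 2 ≤ (c * ‖(P v : U)‖) ^ 2
    rw [mul_pow] at h3 h4 ⊢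
    rw [h1, h2] at h3
    linarith

theorem norm_map_add_le (T : U →ₗ[ℝ] W) {L : Submodule ℝ U}
    (horth : ∀ v ∈ L, ∀ w ∈ Lᗮ, ⟪T v, T w⟫ = (0 : ℝ)) {c : ℝ} (hc : 0 ≤ c) {a b : U}
    (ha : a ∈ L) (hb : b ∈ Lᗮ) (hTa : ‖T a‖ ≤ c * ‖a‖) (hTb : ‖T b‖ ≤ c * ‖b‖) :
    ‖T (a + b)‖ ≤ c * ‖a + b‖ := by
  refine le_of_sq_le_sq ?_ (by positivity)
  rw [norm_map_add_sq T horth ha hb, mul_pow, norm_add_sq_of_mem_orthogonal ha hb]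
  have h1 := pow_le_pow_left₀ (norm_nonneg _) hTa 2
  have h2 := pow_le_pow_left₀ (norm_nonneg _) hTb 2
  rw [mul_pow] at h1 h2
  linarith

end SingularValueComparison

/-- Let `k ≥ 2`, `1 ≤ l ≤ k−1`, let `U`, `W` be `k`-dimensional real inner
product spaces, `A : U → W` an invertible linear map, and `L ⊆ U` an `l`-dimensional subspace.
If `‖A|_L‖ < 𝔪(A|_{L⊥})` and `A(L⊥)` is orthogonal to `A(L)`, then `σ_i(A|_L) = σ_i(A)` for
`1 ≤ i ≤ l` and `σ_{i−l}(A|_{L⊥}) = σ_i(A)` for `l+1 ≤ i ≤ k`; here restrictions carry the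
induced inner products. -/
theorem stmt0 {U W : Type*} [NormedAddCommGroup U] [InnerProductSpace ℝ U]
    [NormedAddCommGroup W] [InnerProductSpace ℝ W]
    [FiniteDimensional ℝ U] [FiniteDimensional ℝ W]
    (k l : ℕ) (hk : 2 ≤ k) (hl : 1 ≤ l) (hlk : l + 1 ≤ k)
    (hU : finrank ℝ U = k) (hW : finrank ℝ W = k)
    (A : U ≃ₗ[ℝ] W) (L : Submodule ℝ U) (hL : finrank ℝ L = l)
    (hnorm : opNorm' ((A : U →ₗ[ℝ] W).comp L.subtype) <
      conorm' ((A : U →ₗ[ℝ] W).comp Lᗮ.subtype))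
    (horth : ∀ v ∈ L, ∀ w ∈ Lᗮ, ⟪A v, A w⟫ = (0 : ℝ)) :
    (∀ i : ℕ, 1 ≤ i → i ≤ l →
      singularValue ((A : U →ₗ[ℝ] W).comp L.subtype) i =
        singularValue (A : U →ₗ[ℝ] W) i) ∧
    (∀ i : ℕ, l + 1 ≤ i → i ≤ k →
      singularValue ((A : U →ₗ[ℝ] W).comp Lᗮ.subtype) (i - l) =
        singularValue (A : U →ₗ[ℝ] W) i) := by
  have hop : ∀ v ∈ L, ‖A v‖ ≤ opNorm' ((A : U →ₗ[ℝ] W).comp L.subtype) * ‖v‖ :=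
    fun v hv => norm_map_le_opNorm'_mul_norm ((A : U →ₗ[ℝ] W).comp L.subtype) ⟨v, hv⟩
  have hco : ∀ v ∈ Lᗮ, conorm' ((A : U →ₗ[ℝ] W).comp Lᗮ.subtype) * ‖v‖ ≤ ‖A v‖ :=
    fun v hv => conorm'_mul_norm_le_norm_map ((A : U →ₗ[ℝ] W).comp Lᗮ.subtype) ⟨v, hv⟩
  have hop_le : ∀ c, conorm' ((A : U →ₗ[ℝ] W).comp Lᗮ.subtype) ≤ c → ∀ v ∈ L,
      ‖A v‖ ≤ c * ‖v‖ := fun c hc v hv =>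
    (hop v hv).trans (mul_le_mul_of_nonneg_right (hnorm.le.trans hc) (norm_nonneg v))
  have hperp := L.finrank_add_finrank_orthogonal
  refine ⟨fun i _ hil => le_antisymm ?_ ?_, fun i hli hik => le_antisymm ?_ ?_⟩
  · refine singularValue_le_singularValue _ _ (by omega) fun V c hV hc hbd => ?_
    rcases lt_or_ge c (conorm' ((A : U →ₗ[ℝ] W).comp Lᗮ.subtype)) with hcm | hcm
    · obtain ⟨V', hV', h⟩ :=
        exists_submodule_of_norm_map_le (A : U →ₗ[ℝ] W) horth hc hcm hco hbd
      exact ⟨V', hV'.trans hV, h⟩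
    · obtain ⟨V', -, hV'⟩ := exists_submodule_le_finrank_eq (⊤ : Submodule ℝ L) (n := i)
        (by rw [finrank_top]; omega)
      exact ⟨V', hV', fun v _ => hop_le c hcm v v.2⟩
  · refine singularValue_le_singularValue _ _ (by omega) fun V c hV _ hbd => ?_
    refine ⟨V.map L.subtype, by rw [Submodule.finrank_map_subtype_eq, hV], ?_⟩
    rintro _ ⟨v, hv, rfl⟩
    exact hbd v hv
  · refine singularValue_le_singularValue _ _ (by omega) fun V c hV _ hbd => ?_
    obtain ⟨V', hle, hV'⟩ := exists_submodule_le_finrank_eq (V.comap Lᗮ.subtype) (n := i - l)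
      (by have := finrank_le_finrank_comap_subtype_orthogonal L V; omega)
    exact ⟨V', hV', fun v hv => hbd v (hle hv)⟩
  · refine singularValue_le_singularValue _ _ (by omega) fun V c hV hc hbd => ?_
    have hdisj : Disjoint L (V.map Lᗮ.subtype) :=
      L.orthogonal_disjoint.mono_right (Submodule.map_subtype_le _ _)
    refine ⟨L ⊔ V.map Lᗮ.subtype, ?_, ?_⟩
    · have h := Submodule.finrank_sup_add_finrank_inf_eq L (V.map Lᗮ.subtype)
      rw [hdisj.eq_bot, finrank_bot, Submodule.finrank_map_subtype_eq] at h
      omega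
    · have hcm : conorm' ((A : U →ₗ[ℝ] W).comp Lᗮ.subtype) ≤ c := by
        have hVne : V ≠ ⊥ := by
          rintro rfl
          rw [finrank_bot] at hV
          omega
        obtain ⟨v, hv, hv0⟩ := V.exists_mem_ne_zero_of_ne_bot hVne
        exact le_of_mul_le_mul_right ((hco v v.2).trans (hbd v hv))
          (norm_pos_iff (a := v).mpr hv0)
      intro v hv
      obtain ⟨a, ha, _, ⟨b, hb, rfl⟩, rfl⟩ := Submodule.mem_sup.mp hv
      exact norm_map_add_le (A : U →ₗ[ℝ] W) horth hc ha b.2 (hop_le c hcm a ha) (hbd b hb)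
end

section
/- Let f be a continuous flow on a metric space M and let γ, β : M → (0,∞) be continuous. Let g be a time change of f with speed multiplier γ, and let h be a time change of g with speed multiplier β. Let τ denote the additive cocycle over g generated by γ, ω the additive cocycle over h generated by β, and θ the additive cocycle over h generated by the product γ·β. Then h is the time change of f with speed multiplier γ·β, i.e. h^t(x) = f^{θ(t,x)}(x) for all t ∈ ℝ and x ∈ M, and moreover θ(t,x) = τ(ω(t,x), x) for all t ∈ ℝ and x ∈ M. In particular, taking h = f and β = γ^{−1}, if ω denotes the additive cocycle over f generated by γ^{−1}, then τ(ω(t,x), x) = ω(τ(t,x), x) = t for all t ∈ ℝ and x ∈ M. -/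
open MeasureTheory intervalIntegral

/-- The additive cocycle over the flow `g` generated by `γ`:
`τ(t,x) = ∫₀^t γ(g^s x) ds`. -/
noncomputable def addCocycle {M : Type*} [TopologicalSpace M] (g : Flow ℝ M) (γ : M → ℝ)
    (t : ℝ) (x : M) : ℝ :=
  ∫ s in (0 : ℝ)..t, γ (g s x)

/-- The flow `g` is a time change of `f` with speed multiplier `γ`:
`g^t(x) = f^{τ(t,x)}(x)` where `τ` is the additive cocycle over `g` generated by `γ`. -/
def IsTimeChange {M : Type*} [TopologicalSpace M] (f g : Flow ℝ M) (γ : M → ℝ) : Prop :=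
  ∀ t x, g t x = f (addCocycle g γ t x) x

section AddCocycle

variable {M : Type*} [TopologicalSpace M]

theorem hasDerivAt_addCocycle (g : Flow ℝ M) {γ : M → ℝ} (hγ : Continuous γ) (t : ℝ) (x : M) :
    HasDerivAt (fun t => addCocycle g γ t x) (γ (g t x)) t :=
  have hc : Continuous fun s => γ (g s x) := hγ.comp (g.continuous continuous_id continuous_const)
  integral_hasDerivAt_right (hc.intervalIntegrable _ _)
    (hc.stronglyMeasurableAtFilter _ _) hc.continuousAt

theorem addCocycle_zero (g : Flow ℝ M) (γ : M → ℝ) (x : M) : addCocycle g γ 0 x = 0 :=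
  integral_same

theorem strictMono_addCocycle (g : Flow ℝ M) {γ : M → ℝ} (hγ : Continuous γ)
    (hpos : ∀ x, 0 < γ x) (x : M) : StrictMono fun t => addCocycle g γ t x :=
  strictMono_of_hasDerivAt_pos (fun t => hasDerivAt_addCocycle g hγ t x) fun t => hpos (g t x)

/-- The cocycle generated by a product of speed multipliers is the composition of the cocycles. -/
theorem IsTimeChange.addCocycle_mul {g h : Flow ℝ M} {γ β : M → ℝ} (hγ : Continuous γ)
    (hβ : Continuous β) (hh : IsTimeChange g h β) (t : ℝ) (x : M) :
    addCocycle h (fun x => γ x * β x) t x = addCocycle g γ (addCocycle h β t x) x := by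
  have hθ (s : ℝ) := hasDerivAt_addCocycle h (hγ.mul hβ) s x
  have hτω (s : ℝ) : HasDerivAt (fun s => addCocycle g γ (addCocycle h β s x) x)
      (γ (h s x) * β (h s x)) s := by
    have := (hasDerivAt_addCocycle g hγ (addCocycle h β s x) x).comp s
      (hasDerivAt_addCocycle h hβ s x)
    rwa [← hh s x] at this
  refine congrFun (eq_of_fderiv_eq (𝕜 := ℝ) (fun s => (hθ s).differentiableAt)
    (fun s => (hτω s).differentiableAt) (fun s => ?_) 0 ?_) t
  · exact (hθ s).hasFDerivAt.fderiv.trans (hτω s).hasFDerivAt.fderiv.symm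
  · simp only [addCocycle_zero]

end AddCocycle

/-- If `g` is a time change of `f` with speed multiplier `γ` and `h` is a
time change of `g` with speed multiplier `β`, then `h` is a time change of `f` with speed
multiplier `γ·β`, and the corresponding cocycles satisfy `θ(t,x) = τ(ω(t,x),x)`.
In particular, taking `h = f` and `β = γ⁻¹`, one gets `τ(ω(t,x),x) = ω(τ(t,x),x) = t`. -/
theorem stmt2 {M : Type*} [MetricSpace M] (f g h : Flow ℝ M) (γ β : M → ℝ)
    (hγc : Continuous γ) (hγpos : ∀ x, 0 < γ x)
    (hβc : Continuous β) (hβpos : ∀ x, 0 < β x)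
    (hg : IsTimeChange f g γ) (hh : IsTimeChange g h β) :
    IsTimeChange f h (fun x => γ x * β x) ∧
    (∀ t x, addCocycle h (fun x => γ x * β x) t x =
      addCocycle g γ (addCocycle h β t x) x) ∧
    (h = f → β = (fun x => (γ x)⁻¹) →
      ∀ t x, addCocycle g γ (addCocycle f (fun x => (γ x)⁻¹) t x) x = t ∧
        addCocycle f (fun x => (γ x)⁻¹) (addCocycle g γ t x) x = t) := by
  have hθ := hh.addCocycle_mul hγc hβc
  refine ⟨fun t x => ?_, hθ, ?_⟩
  · rw [hθ, ← hg, ← hh]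
  · rintro rfl rfl
    have hτω (t : ℝ) (x : M) :
        addCocycle g γ (addCocycle h (fun x => (γ x)⁻¹) t x) x = t := by
      rw [← hθ]
      simp [addCocycle, mul_inv_cancel₀ (hγpos _).ne']
    exact fun t x => ⟨hτω t x, (strictMono_addCocycle g hγc hγpos x).injective (hτω _ x)⟩
end

section
/- Let M be a compact metric space, f a continuous flow on M, and γ : M → (0,∞) continuous. For x ∈ M and s ∈ ℝ set ω(s,x) = ∫₀^s γ(f^r(x))^{−1} dr. Then: (1) for each x ∈ M the map s ↦ ω(s,x) is a strictly increasing homeomorphism of ℝ onto ℝ, so for each t ∈ ℝ there is a unique real number τ(t,x) with ω(τ(t,x), x) = t; (2) setting g^t(x) = f^{τ(t,x)}(x), the family {g^t}_{t∈ℝ} is a continuous flow on M; and (3) τ(t,x) = ∫₀^t γ(g^s(x)) ds for all t ∈ ℝ and x ∈ M, i.e. τ is the additive cocycle over g generated by γ, so that g is the time change of f with speed multiplier γ. -/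
open MeasureTheory intervalIntegral

/-- `ω(s,x) = ∫₀^s γ(f^r x)⁻¹ dr`. -/
noncomputable def omegaCocycle {M : Type*} [TopologicalSpace M] (f : Flow ℝ M) (γ : M → ℝ)
    (s : ℝ) (x : M) : ℝ :=
  ∫ r in (0 : ℝ)..s, (γ (f r x))⁻¹

section OmegaCocycle

variable {M : Type*} [TopologicalSpace M] (f : Flow ℝ M) {γ : M → ℝ}

lemma continuous_inv_comp_flow (hγc : Continuous γ) (hγpos : ∀ x, 0 < γ x) :
    Continuous fun p : M × ℝ => (γ (f p.2 p.1))⁻¹ :=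
  (hγc.comp (f.continuous continuous_snd continuous_fst)).inv₀ fun _ => (hγpos _).ne'

lemma hasDerivAt_omegaCocycle (hγc : Continuous γ) (hγpos : ∀ x, 0 < γ x) (x : M) (s : ℝ) :
    HasDerivAt (fun s => omegaCocycle f γ s x) (γ (f s x))⁻¹ s := by
  have hc : Continuous fun r : ℝ => (γ (f r x))⁻¹ :=
    (continuous_inv_comp_flow f hγc hγpos).comp (Continuous.prodMk_right x)
  exact (hc.integral_hasStrictDerivAt 0 s).hasDerivAt

lemma continuous_omegaCocycle_right (hγc : Continuous γ) (hγpos : ∀ x, 0 < γ x) (s : ℝ) :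
    Continuous fun x => omegaCocycle f γ s x :=
  continuous_parametric_intervalIntegral_of_continuous
    (f := fun x r => (γ (f r x))⁻¹) (continuous_inv_comp_flow f hγc hγpos) continuous_const

lemma omegaCocycle_strictMono (hγc : Continuous γ) (hγpos : ∀ x, 0 < γ x) (x : M) :
    StrictMono fun s => omegaCocycle f γ s x :=
  strictMono_of_deriv_pos fun s => by
    rw [(hasDerivAt_omegaCocycle f hγc hγpos x s).deriv]
    exact inv_pos.2 (hγpos _)

lemma omegaCocycle_zero (x : M) : omegaCocycle f γ 0 x = 0 := by
  simp [omegaCocycle]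

lemma omegaCocycle_add (hγc : Continuous γ) (hγpos : ∀ x, 0 < γ x) (s r : ℝ) (x : M) :
    omegaCocycle f γ (s + r) x = omegaCocycle f γ s (f r x) + omegaCocycle f γ r x := by
  have hc : Continuous fun u : ℝ => (γ (f u x))⁻¹ :=
    (continuous_inv_comp_flow f hγc hγpos).comp (Continuous.prodMk_right x)
  have h : omegaCocycle f γ s (f r x) = ∫ u in r..s + r, (γ (f u x))⁻¹ := by
    simp only [omegaCocycle, ← f.map_add]
    rw [intervalIntegral.integral_comp_add_right (fun u => (γ (f u x))⁻¹), zero_add]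
  rw [h, eq_comm, add_comm]
  exact integral_add_adjacent_intervals (hc.intervalIntegrable _ _)
    (hc.intervalIntegrable _ _)

variable {C : ℝ}

lemma mul_sub_le_omegaCocycle_sub (hγc : Continuous γ) (hγpos : ∀ x, 0 < γ x)
    (hC : ∀ x, γ x ≤ C) (x : M) {r s : ℝ} (hrs : r ≤ s) :
    C⁻¹ * (s - r) ≤ omegaCocycle f γ s x - omegaCocycle f γ r x :=
  mul_sub_le_image_sub_of_le_deriv
    (fun u => (hasDerivAt_omegaCocycle f hγc hγpos x u).differentiableAt)
    (fun u => by
      rw [(hasDerivAt_omegaCocycle f hγc hγpos x u).deriv]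
      exact inv_anti₀ (hγpos _) (hC _)) hrs

lemma abs_sub_le_mul_abs_omegaCocycle_sub (hγc : Continuous γ) (hγpos : ∀ x, 0 < γ x)
    (hC : ∀ x, γ x ≤ C) (x : M) (r s : ℝ) :
    |s - r| ≤ C * |omegaCocycle f γ s x - omegaCocycle f γ r x| := by
  have hC0 : 0 < C := (hγpos x).trans_le (hC x)
  wlog hrs : r ≤ s generalizing r s
  · rw [abs_sub_comm, abs_sub_comm (omegaCocycle f γ s x)]
    exact this s r (le_of_not_ge hrs)
  rw [abs_of_nonneg (sub_nonneg.2 hrs), ← inv_mul_le_iff₀ hC0]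
  exact (mul_sub_le_omegaCocycle_sub f hγc hγpos hC x hrs).trans (le_abs_self _)

lemma omegaCocycle_surjective (hγc : Continuous γ) (hγpos : ∀ x, 0 < γ x)
    (hC : ∀ x, γ x ≤ C) (x : M) :
    Function.Surjective fun s => omegaCocycle f γ s x := by
  have hC0 : 0 < C⁻¹ := inv_pos.2 ((hγpos x).trans_le (hC x))
  have hcont : Continuous fun s => omegaCocycle f γ s x :=
    continuous_iff_continuousAt.2 fun s => (hasDerivAt_omegaCocycle f hγc hγpos x s).continuousAt
  refine hcont.surjective
    (Filter.tendsto_atTop_mono' _ ?_ (Filter.tendsto_id.const_mul_atTop hC0))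
    (Filter.tendsto_atBot_mono' _ ?_ (Filter.tendsto_id.const_mul_atBot hC0))
  · filter_upwards [Filter.eventually_ge_atTop 0] with s hs
    simpa [omegaCocycle_zero] using mul_sub_le_omegaCocycle_sub f hγc hγpos hC x hs
  · filter_upwards [Filter.eventually_le_atBot 0] with s hs
    have h := mul_sub_le_omegaCocycle_sub f hγc hγpos hC x hs
    rw [omegaCocycle_zero] at h
    simp only [id]
    linarith

lemma continuous_of_omegaCocycle_eq (hγc : Continuous γ) (hγpos : ∀ x, 0 < γ x)
    (hC : ∀ x, γ x ≤ C) {τ : ℝ → M → ℝ} (hτ : ∀ t x, omegaCocycle f γ (τ t x) x = t) :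
    Continuous fun p : ℝ × M => τ p.1 p.2 := by
  refine continuous_iff_continuousAt.2 fun p₀ => tendsto_iff_dist_tendsto_zero.2 ?_
  have hlim : Continuous fun p : ℝ × M => C * |p.1 - omegaCocycle f γ (τ p₀.1 p₀.2) p.2| :=
    continuous_const.mul (continuous_fst.sub
      ((continuous_omegaCocycle_right f hγc hγpos _).comp continuous_snd)).abs
  refine squeeze_zero (fun _ => dist_nonneg) (fun p => ?_)
    ((hlim.tendsto p₀).trans_eq (by rw [hτ, sub_self, abs_zero, mul_zero]))
  simpa only [hτ, Real.dist_eq] using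
    abs_sub_le_mul_abs_omegaCocycle_sub f hγc hγpos hC p.2 (τ p₀.1 p₀.2) (τ p.1 p.2)

end OmegaCocycle

/-- Construction of the time change of `f` with speed multiplier `γ`:
(1) for each `x` the map `s ↦ ω(s,x)` is a strictly increasing homeomorphism of `ℝ` onto `ℝ`
(strictly monotone, continuous, bijective), so for each `t` there is a unique `τ(t,x)` with
`ω(τ(t,x),x) = t`; (2) `g^t(x) = f^{τ(t,x)}(x)` defines a continuous flow on `M`; and
(3) `τ` is the additive cocycle over `g` generated by `γ`, so `g` is the time change of `f`
with speed multiplier `γ`. -/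
theorem stmt3 {M : Type*} [MetricSpace M] [CompactSpace M] (f : Flow ℝ M) (γ : M → ℝ)
    (hγc : Continuous γ) (hγpos : ∀ x, 0 < γ x) :
    (∀ x : M, StrictMono (fun s => omegaCocycle f γ s x) ∧
      Continuous (fun s => omegaCocycle f γ s x) ∧
      Function.Bijective (fun s => omegaCocycle f γ s x)) ∧
    (∀ τ : ℝ → M → ℝ, (∀ t x, omegaCocycle f γ (τ t x) x = t) →
      ∃ g : Flow ℝ M, (∀ t x, g t x = f (τ t x) x) ∧
        ∀ t x, τ t x = addCocycle g γ t x) := by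
  obtain ⟨C, hC⟩ : ∃ C, ∀ x, γ x ≤ C := by
    obtain ⟨C, hC⟩ := (isCompact_range hγc).bddAbove
    exact ⟨C, fun x => hC ⟨x, rfl⟩⟩
  have hinj (x : M) := (omegaCocycle_strictMono f hγc hγpos x).injective
  refine ⟨fun x => ⟨omegaCocycle_strictMono f hγc hγpos x, continuous_iff_continuousAt.2 fun s =>
    (hasDerivAt_omegaCocycle f hγc hγpos x s).continuousAt, hinj x,
    omegaCocycle_surjective f hγc hγpos hC x⟩, fun τ hτ => ?_⟩
  have hτc := continuous_of_omegaCocycle_eq f hγc hγpos hC hτ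
  have hτ0 (x : M) : τ 0 x = 0 := hinj x ((hτ 0 x).trans (omegaCocycle_zero f x).symm)
  have hτadd (t s : ℝ) (x : M) : τ (t + s) x = τ t (f (τ s x) x) + τ s x :=
    hinj x (by simp only [omegaCocycle_add f hγc hγpos, hτ])
  have hgc : Continuous fun p : ℝ × M => f (τ p.1 p.2) p.2 := f.continuous hτc continuous_snd
  refine ⟨⟨fun t x => f (τ t x) x, hgc, fun t s x => ?_, fun x => ?_⟩, fun _ _ => rfl,
    fun t x => ?_⟩
  · rw [hτadd, f.map_add]
  · rw [hτ0, f.map_zero_apply]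
  · have hderiv (s : ℝ) : HasDerivAt (fun s => τ s x) (γ (f (τ s x) x)) s := by
      have h := HasDerivAt.of_local_left_inverse
        (hτc.comp (Continuous.prodMk_left x)).continuousAt
        (hasDerivAt_omegaCocycle f hγc hγpos x (τ s x)) (inv_pos.2 (hγpos _)).ne'
        (Filter.Eventually.of_forall fun y => hτ y x)
      rwa [inv_inv] at h
    have hint : Continuous fun s => γ (f (τ s x) x) :=
      hγc.comp (hgc.comp (Continuous.prodMk_left x))
    have h := integral_eq_sub_of_hasDerivAt (fun s _ => hderiv s) (hint.intervalIntegrable 0 t)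
    rw [hτ0, sub_zero] at h
    exact h.symm
end

section
/- Let (M,d) be a metric space, f : M → M a map, and a > 0, α ∈ (0,1], χ₂ ∈ ℝ, K > 0 constants with a·α + χ₂ > 0. Suppose d(f^n(x), f^n(y)) ≤ e^{a n} d(x,y) for all x,y ∈ M and n ≥ 1, and suppose A : M → L(ℝ^q, ℝ^q) assigns to each point a linear map of ℝ^q with ‖A_x‖ ≤ e^{χ₂} for all x ∈ M and ‖A_x − A_y‖ ≤ K d(x,y)^α for all x,y ∈ M. Write A^n_x = A_{f^{n−1}(x)} ⋯ A_{f(x)} A_x. Then there is a constant K′, depending only on K, a, α and χ₂, such that ‖A^n_x − A^n_y‖ ≤ K′ e^{(aα + χ₂)n} d(x,y)^α for all x,y ∈ M and all n ≥ 1. -/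
/-- The cocycle `A^n_x = A_{f^{n−1}(x)} ⋯ A_{f(x)} A_x` generated by `A` over `f`. -/
noncomputable def cocycle {M E : Type*} [NormedAddCommGroup E] [NormedSpace ℝ E]
    (f : M → M) (A : M → (E →L[ℝ] E)) : ℕ → M → (E →L[ℝ] E)
  | 0, _ => ContinuousLinearMap.id ℝ E
  | n + 1, x => (A (f^[n] x)).comp (cocycle f A n x)

section CocycleBounds

variable {M E : Type*} [NormedAddCommGroup E] [NormedSpace ℝ E]
  {f : M → M} {A : M → (E →L[ℝ] E)}

theorem norm_cocycle_le {χ : ℝ} (hA : ∀ x, ‖A x‖ ≤ Real.exp χ) (n : ℕ) (x : M) :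
    ‖cocycle f A n x‖ ≤ Real.exp (χ * n) := by
  induction n with
  | zero => simpa [cocycle] using ContinuousLinearMap.norm_id_le (𝕜 := ℝ) (E := E)
  | succ n ih =>
    calc ‖(A (f^[n] x)).comp (cocycle f A n x)‖
        ≤ ‖A (f^[n] x)‖ * ‖cocycle f A n x‖ := ContinuousLinearMap.opNorm_comp_le _ _
      _ ≤ Real.exp χ * Real.exp (χ * n) := by gcongr; exact hA _
      _ = Real.exp (χ * (n + 1 : ℕ)) := by
        rw [← Real.exp_add]; push_cast; ring_nf

theorem norm_cocycle_succ_sub_le (n : ℕ) (x y : M) :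
    ‖cocycle f A (n + 1) x - cocycle f A (n + 1) y‖ ≤
      ‖A (f^[n] x)‖ * ‖cocycle f A n x - cocycle f A n y‖ +
        ‖A (f^[n] x) - A (f^[n] y)‖ * ‖cocycle f A n y‖ := by
  have h : cocycle f A (n + 1) x - cocycle f A (n + 1) y =
      (A (f^[n] x)).comp (cocycle f A n x - cocycle f A n y) +
        (A (f^[n] x) - A (f^[n] y)).comp (cocycle f A n y) := by
    ext v
    simp [cocycle]
  rw [h]
  exact (norm_add_le _ _).trans (add_le_add (ContinuousLinearMap.opNorm_comp_le _ _)
    (ContinuousLinearMap.opNorm_comp_le _ _))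

theorem norm_sub_comp_iterate_le [PseudoMetricSpace M] {a α K : ℝ} (hα : 0 ≤ α) (hK : 0 ≤ K)
    (hA : ∀ x y, ‖A x - A y‖ ≤ K * dist x y ^ α) {n : ℕ} {x y : M}
    (hf : dist (f^[n] x) (f^[n] y) ≤ Real.exp (a * n) * dist x y) :
    ‖A (f^[n] x) - A (f^[n] y)‖ ≤ K * (Real.exp (a * α * n) * dist x y ^ α) := by
  refine (hA _ _).trans ?_
  gcongr
  calc dist (f^[n] x) (f^[n] y) ^ α
      ≤ (Real.exp (a * n) * dist x y) ^ α := by gcongr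
    _ = Real.exp (a * α * n) * dist x y ^ α := by
      rw [Real.mul_rpow (Real.exp_pos _).le dist_nonneg, ← Real.exp_mul]
      ring_nf

end CocycleBounds

/-- Hölder continuity of cocycle products: given `a > 0`, `α ∈ (0,1]`,
`χ₂ ∈ ℝ`, `K > 0` with `aα + χ₂ > 0`, there is a constant `K′` depending only on
`K, a, α, χ₂` such that for every metric space `M`, every map `f : M → M` with
`d(fⁿx, fⁿy) ≤ e^{an} d(x,y)` for `n ≥ 1`, and every `A : M → L(ℝ^q,ℝ^q)` with
`‖A_x‖ ≤ e^{χ₂}` and `‖A_x − A_y‖ ≤ K d(x,y)^α`, one has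
`‖A^n_x − A^n_y‖ ≤ K′ e^{(aα+χ₂)n} d(x,y)^α` for all `x, y` and `n ≥ 1`. -/
theorem stmt11 (a α χ₂ K : ℝ) (ha : 0 < a) (hα : 0 < α) (hα1 : α ≤ 1) (hK : 0 < K)
    (hsum : 0 < a * α + χ₂) :
    ∃ K' : ℝ, 0 < K' ∧
      ∀ (M : Type) (_ : MetricSpace M) (q : ℕ) (f : M → M),
        (∀ x y : M, ∀ n : ℕ, 1 ≤ n →
          dist (f^[n] x) (f^[n] y) ≤ Real.exp (a * n) * dist x y) →
        ∀ A : M → (EuclideanSpace ℝ (Fin q) →L[ℝ] EuclideanSpace ℝ (Fin q)),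
          (∀ x : M, ‖A x‖ ≤ Real.exp χ₂) →
          (∀ x y : M, ‖A x - A y‖ ≤ K * dist x y ^ α) →
          ∀ x y : M, ∀ n : ℕ, 1 ≤ n →
            ‖cocycle f A n x - cocycle f A n y‖ ≤
              K' * Real.exp ((a * α + χ₂) * n) * dist x y ^ α := by
  have hgap : 0 < Real.exp (a * α + χ₂) - Real.exp χ₂ :=
    sub_pos.2 (Real.exp_lt_exp.2 (lt_add_of_pos_left _ (mul_pos ha hα)))
  refine ⟨K / (Real.exp (a * α + χ₂) - Real.exp χ₂), div_pos hK hgap, ?_⟩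
  intro M _ q f hf A hA hAK x y n _
  set K' := K / (Real.exp (a * α + χ₂) - Real.exp χ₂) with hK'
  have hK'_eq : Real.exp χ₂ * K' + K = K' * Real.exp (a * α + χ₂) := by
    rw [hK']; field_simp; ring
  have hK'_pos : 0 < K' := div_pos hK hgap
  induction n with
  | zero => omega
  | succ n ih =>
    have hdiff : ‖cocycle f A n x - cocycle f A n y‖ ≤
        K' * Real.exp ((a * α + χ₂) * n) * dist x y ^ α := by
      rcases n.eq_zero_or_pos with rfl | hn
      · simp only [cocycle, sub_self, norm_zero]
        positivity
      · exact ih hn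
    have hdist : dist (f^[n] x) (f^[n] y) ≤ Real.exp (a * n) * dist x y := by
      rcases n.eq_zero_or_pos with rfl | hn
      · simp
      · exact hf x y n hn
    calc ‖cocycle f A (n + 1) x - cocycle f A (n + 1) y‖
        ≤ ‖A (f^[n] x)‖ * ‖cocycle f A n x - cocycle f A n y‖ +
            ‖A (f^[n] x) - A (f^[n] y)‖ * ‖cocycle f A n y‖ := norm_cocycle_succ_sub_le n x y
      _ ≤ Real.exp χ₂ * (K' * Real.exp ((a * α + χ₂) * n) * dist x y ^ α) +
            K * (Real.exp (a * α * n) * dist x y ^ α) * Real.exp (χ₂ * n) := by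
          gcongr
          · exact hA _
          · exact norm_sub_comp_iterate_le hα.le hK.le hAK hdist
          · exact norm_cocycle_le hA n y
      _ = (Real.exp χ₂ * K' + K) * Real.exp ((a * α + χ₂) * n) * dist x y ^ α := by
          rw [add_mul (a * α), Real.exp_add]; ring
      _ = K' * Real.exp ((a * α + χ₂) * (n + 1 : ℕ)) * dist x y ^ α := by
          rw [hK'_eq, mul_assoc K', ← Real.exp_add]; push_cast; ring_nf
end
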